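/- Let F be a free group, let z ∈ F be nontrivial, and let a₁, …, aₙ ∈ F be elements none of which commutes with z. Then for all sufficiently large values of |m₁|, …, |m_{n-1}| (with m_n arbitrary nonzero), the element w = a₁ z^{m₁} a₂ z^{m₂} ⋯ aₙ z^{mₙ} does not commute with z. In particular, w ≠ 1. -/

import Mathlib

namespace FreeGroup

theorem isCyclicallyReduced_invRev {α : Type*} {L : List (α × Bool)}
    (h : IsCyclicallyReduced L) : IsCyclicallyReduced (invRev L) := by
  classical
  refine ⟨?_, fun x hx y hy hxy => ?_⟩
  · rw [isReduced_iff_reduce_eq, reduce_invRev, h.isReduced.reduce_eq]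
  · simp only [invRev, List.getLast?_reverse, List.head?_reverse, List.head?_map,
      List.getLast?_map, Option.mem_def, Option.map_eq_some_iff] at hx hy
    obtain ⟨x, hx, rfl⟩ := hx
    obtain ⟨y, hy, rfl⟩ := hy
    simpa using (h.2 y hy x hx hxy.symm).symm

theorem IsReduced.exists_cancellation {α : Type*} {L₁ L₂ : List (α × Bool)}
    (h₁ : IsReduced L₁) (h₂ : IsReduced L₂) :
    ∃ p q r, L₁ = p ++ q ∧ L₂ = invRev q ++ r ∧ IsReduced (p ++ r) := by
  induction L₁ using List.reverseRecOn generalizing L₂ with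
  | nil => exact ⟨[], [], L₂, by simp, by simp, by simpa⟩
  | append_singleton l x ih =>
    cases L₂ with
    | nil => exact ⟨l ++ [x], [], [], by simp, by simp, by simpa⟩
    | cons y t =>
      by_cases hxy : x.1 = y.1 → x.2 = y.2
      · refine ⟨l ++ [x], [], y :: t, by simp, by simp, ?_⟩
        simp only [IsReduced, List.isChain_append] at *
        refine ⟨h₁, h₂, ?_⟩
        simpa using hxy
      · obtain ⟨p, q, r, rfl, rfl, h⟩ :=
          ih (h₁.infix ⟨[], [x], by simp⟩) (L₂ := t) (h₂.infix ⟨[y], [], by simp⟩)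
        refine ⟨p, q ++ [x], r, by simp, ?_, h⟩
        rw [Classical.not_imp] at hxy
        obtain ⟨x, b⟩ := x
        obtain ⟨y, c⟩ := y
        obtain ⟨rfl, hbc⟩ := hxy
        have : c = !b := by cases b <;> cases c <;> simp_all
        simp [invRev, this]

theorem commute_of_conj_eq_inv {α : Type*} {a z : FreeGroup α} (h : a * z = z⁻¹ * a) : Commute a z := by
  have h₁ : (a * z) ^ 2 = a ^ 2 := by
    have : z * (a * z) = a := by rw [h, mul_inv_cancel_left]
    rw [pow_two, pow_two, mul_assoc, this]
  have h₂ : a * z = a := pow_left_injective two_ne_zero h₁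
  rw [mul_eq_left.1 h₂]
  exact Commute.one_right a

section

variable {α : Type*} [DecidableEq α]

theorem exists_toWord_mul (g h : FreeGroup α) :
    ∃ p q r, g.toWord = p ++ q ∧ h.toWord = invRev q ++ r ∧ (g * h).toWord = p ++ r := by
  obtain ⟨p, q, r, hg, hh, hr⟩ :=
    IsReduced.exists_cancellation (isReduced_toWord (x := g)) (isReduced_toWord (x := h))
  refine ⟨p, q, r, hg, hh, ?_⟩
  rw [← hr.reduce_eq, ← toWord_mk]
  congr 1
  rw [← mk_toWord (x := g), ← mk_toWord (x := h), hg, hh]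
  simp only [← mul_mk, ← inv_mk]
  group

theorem toWord_pow_of_isCyclicallyReduced {z : FreeGroup α} (hz : IsCyclicallyReduced z.toWord)
    (n : ℕ) : (z ^ n).toWord = (List.replicate n z.toWord).flatten := by
  rw [toWord_pow, (hz.flatten_replicate n).isReduced.reduce_eq]

theorem exists_zpow_eq_pow {z : FreeGroup α} (hz : IsCyclicallyReduced z.toWord) (k : ℤ) :
    ∃ y : FreeGroup α, (y = z ∨ y = z⁻¹) ∧ IsCyclicallyReduced y.toWord ∧ y.norm = z.norm ∧
      z ^ k = y ^ k.natAbs := by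
  obtain h | h := Int.natAbs_eq k
  · exact ⟨z, .inl rfl, hz, rfl, by rw [← zpow_natCast, ← h]⟩
  · refine ⟨z⁻¹, .inr rfl, ?_, norm_inv_eq, ?_⟩
    · rw [toWord_inv]
      exact isCyclicallyReduced_invRev hz
    · rw [← zpow_natCast, inv_zpow, ← zpow_neg, ← h]

theorem norm_zpow_of_isCyclicallyReduced {z : FreeGroup α} (hz : IsCyclicallyReduced z.toWord)
    (k : ℤ) : (z ^ k).norm = k.natAbs * z.norm := by
  obtain ⟨y, -, hy, hn, hk⟩ := exists_zpow_eq_pow hz k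
  rw [hk, ← hn, norm, toWord_pow_of_isCyclicallyReduced hy]
  simp [norm]

/-- Along the periodic word of `y ^ n`, left multiplication by `y` shifts prefixes by one period. -/
theorem mk_eq_mul_mk_of_prefix {y : FreeGroup α} (hy : IsCyclicallyReduced y.toWord)
    {p q : List (α × Bool)} (n : ℕ) (hq : q.length = y.norm) (h : p ++ q <+: (y ^ n).toWord) :
    mk (p ++ q) = y * mk p := by
  rw [toWord_pow_of_isCyclicallyReduced hy] at h
  have h₁ : p ++ q <+: (List.replicate (n + 1) y.toWord).flatten := by
    rw [List.replicate_succ', List.flatten_append]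
    exact h.trans (List.prefix_append _ _)
  have h₂ : y.toWord ++ p <+: (List.replicate (n + 1) y.toWord).flatten := by
    rw [List.replicate_succ, List.flatten_cons, List.prefix_append_right_inj]
    exact (List.prefix_append _ _).trans h
  have h₃ : p ++ q = y.toWord ++ p :=
    (List.prefix_of_prefix_length_le h₁ h₂ (by simp [hq, norm, add_comm])).eq_of_length
      (by simp [hq, norm, add_comm])
  rw [h₃, ← mul_mk, mk_toWord]

/-- The elements whose reduced word shares a prefix of length at least `L` with a power of `z`. -/
def axisNhd (z : FreeGroup α) (L : ℕ) : Set (FreeGroup α) :=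
  {g | ∃ k : ℤ, ∃ p, L ≤ p.length ∧ p <+: g.toWord ∧ p <+: (z ^ k).toWord}

theorem zpow_mul_mem_axisNhd {z : FreeGroup α} {L B : ℕ} {k : ℤ} {g : FreeGroup α}
    (hB : g ∉ axisNhd z B) (hk : L + B ≤ (z ^ k).norm) : z ^ k * g ∈ axisNhd z L := by
  obtain ⟨p, q, r, h₁, h₂, h₃⟩ := exists_toWord_mul (z ^ k) g
  have hq : q.length < B := by
    by_contra! hq
    refine hB ⟨-k, invRev q, by simpa, by simp [h₂], ?_⟩
    rw [zpow_neg, toWord_inv, h₁]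
    simp
  refine ⟨k, p, ?_, by simp [h₃], by simp [h₁]⟩
  have := congrArg List.length h₁
  rw [List.length_append] at this
  change _ ≤ (z ^ k).toWord.length at hk
  lia

theorem notMem_axisNhd {z g : FreeGroup α} {L : ℕ} (h : g.norm < L) : g ∉ axisNhd z L := by
  rintro ⟨k, p, hp, hg, -⟩
  exact absurd hg.length_le (by change _ < _ at h; rw [norm] at h; lia)

theorem mul_notMem_axisNhd {a z : FreeGroup α} (hz : IsCyclicallyReduced z.toWord)
    (ha : ¬ Commute a z) {L : ℕ} (hL : a.norm + z.norm ≤ L) {g : FreeGroup α}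
    (hg : g ∈ axisNhd z L) : a * g ∉ axisNhd z L := by
  rintro ⟨l, p₂, hp₂, hag, hl⟩
  obtain ⟨k, p₁, hp₁, hg, hk⟩ := hg
  obtain ⟨s, q, r, h₁, h₂, h₃⟩ := exists_toWord_mul a g
  obtain ⟨x, hx, hxc, hxn, hxk⟩ := exists_zpow_eq_pow hz k
  obtain ⟨y, hy, hyc, hyn, hyl⟩ := exists_zpow_eq_pow hz l
  rw [hxk] at hk
  rw [hyl] at hl
  rw [h₂] at hg
  rw [h₃] at hag
  have hlen : a.norm = s.length + q.length := by rw [norm, h₁, List.length_append]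
  have hr := hg.length_le
  rw [List.length_append, invRev_length] at hr
  set t := r.take z.norm with ht
  have htl : t.length = z.norm := by rw [ht, List.length_take]; lia
  have htr : t <+: r := List.take_prefix _ _
  have e₁ := mk_eq_mul_mk_of_prefix hxc (p := invRev q) (q := t) _ (htl.trans hxn.symm)
    ((List.prefix_of_prefix_length_le ((List.prefix_append_right_inj _).2 htr) hg
      (by rw [List.length_append, invRev_length]; lia)).trans hk)
  have e₂ := mk_eq_mul_mk_of_prefix hyc (p := s) (q := t) _ (htl.trans hyn.symm)
    ((List.prefix_of_prefix_length_le ((List.prefix_append_right_inj _).2 htr) hag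
      (by rw [List.length_append]; lia)).trans hl)
  have hA : a = mk s * mk q := by rw [mul_mk, ← h₁, mk_toWord]
  rw [← mul_mk, ← inv_mk] at e₁
  rw [← mul_mk] at e₂
  have key : a * x = y * a := by
    have : mk t = mk q * x * (mk q)⁻¹ := by rw [mul_assoc, ← e₁]; group
    rw [this] at e₂
    rw [hA, ← mul_assoc y, ← e₂]
    group
  apply ha
  rcases hx with rfl | rfl <;> rcases hy with rfl | rfl
  · exact key
  · exact commute_of_conj_eq_inv key
  · exact Commute.inv_right_iff.1 (commute_of_conj_eq_inv (by simpa using key))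
  · exact Commute.inv_right_iff.1 key

theorem prod_mul_notMem_axisNhd {z : FreeGroup α} (hz : IsCyclicallyReduced z.toWord) {L M : ℕ}
    (hM : ∀ k : ℤ, (M : ℤ) ≤ |k| → L + L ≤ (z ^ k).norm) (n : ℕ) (a : Fin (n + 1) → FreeGroup α)
    (ha : ∀ i, ¬ Commute (a i) z) (hL : ∀ i, (a i).norm + z.norm ≤ L) (m : Fin (n + 1) → ℤ)
    (hm : ∀ i : Fin (n + 1), (i : ℕ) < n → (M : ℤ) ≤ |m i|) {x : FreeGroup α}
    (hx : z ^ m (Fin.last n) * x ∈ axisNhd z L) :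
    (List.ofFn fun i => a i * z ^ m i).prod * x ∉ axisNhd z L := by
  induction n with
  | zero => simpa [mul_assoc] using mul_notMem_axisNhd hz (ha 0) (hL 0) hx
  | succ n ih =>
    rw [List.ofFn_succ, List.prod_cons, mul_assoc, mul_assoc]
    refine mul_notMem_axisNhd hz (ha 0) (hL 0) (zpow_mul_mem_axisNhd ?_ (hM _ (hm 0 (by simp))))
    exact ih (fun i => a i.succ) (fun i => ha _) (fun i => hL _) (fun i => m i.succ)
      (fun i hi => hm _ (by simpa using hi)) hx

theorem exists_not_commute_prod_of_isCyclicallyReduced {z : FreeGroup α}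
    (hz : IsCyclicallyReduced z.toWord) (hz₁ : z ≠ 1) (n : ℕ) (a : Fin (n + 1) → FreeGroup α)
    (ha : ∀ i, ¬ Commute (a i) z) :
    ∃ M : ℕ, ∀ m : Fin (n + 1) → ℤ, (∀ i : Fin (n + 1), (i : ℕ) < n → (M : ℤ) ≤ |m i|) →
      ¬ Commute (List.ofFn fun i => a i * z ^ m i).prod z := by
  have hpos : 1 ≤ z.norm := Nat.one_le_iff_ne_zero.2 (norm_eq_zero.not.2 hz₁)
  have hnorm (k : ℤ) : k.natAbs ≤ (z ^ k).norm := by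
    rw [norm_zpow_of_isCyclicallyReduced hz]
    exact Nat.le_mul_of_pos_right _ hpos
  set L := ∑ i, (a i).norm + z.norm with hL
  refine ⟨L + L, fun m hm hc => ?_⟩
  set w := (List.ofFn fun i => a i * z ^ m i).prod
  set k : ℤ := L + w.norm + 1 + |m (Fin.last n)| with hk
  refine prod_mul_notMem_axisNhd hz (L := L) (M := L + L) (fun k hk => (hnorm k).trans' ?_) n a ha
    (fun i => ?_) m hm (x := z ^ k) ?_ ?_
  · rw [Int.abs_eq_natAbs] at hk
    exact_mod_cast hk
  · rw [hL]
    gcongr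
    exact Finset.single_le_sum (f := fun i => (a i).norm) (by simp) (Finset.mem_univ i)
  · rw [← zpow_add, ← mul_one (z ^ _)]
    refine zpow_mul_mem_axisNhd (B := 1) (notMem_axisNhd (by simp)) ((hnorm _).trans' ?_)
    have := neg_abs_le (m (Fin.last n))
    lia
  · change w * z ^ k ∈ _
    rw [(hc.zpow_right k).eq]
    exact zpow_mul_mem_axisNhd (B := w.norm + 1) (notMem_axisNhd (by simp))
      ((hnorm _).trans' (by have := abs_nonneg (m (Fin.last n)); lia))

theorem exists_conj_isCyclicallyReduced (z : FreeGroup α) :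
    ∃ c : FreeGroup α, IsCyclicallyReduced (MulAut.conj c z).toWord := by
  have h := reduceCyclically.isCyclicallyReduced (isReduced_toWord (x := z))
  refine ⟨(mk (reduceCyclically.conjugator z.toWord))⁻¹, ?_⟩
  have e : MulAut.conj (mk (reduceCyclically.conjugator z.toWord))⁻¹ z =
      mk (reduceCyclically z.toWord) := by
    have := congrArg mk (reduceCyclically.conj_conjugator_reduceCyclically z.toWord)
    rw [mk_toWord, ← mul_mk, ← mul_mk, ← inv_mk] at this
    nth_rewrite 2 [← this]
    rw [MulAut.conj_apply]
    group
  rwa [e, toWord_mk, h.isReduced.reduce_eq]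

end

end FreeGroup


/-- Baumslag's Lemma for free groups: Let `F` be a free group, `z ≠ 1`,
and `a₁, …, aₙ ∈ F` with `[aᵢ, z] ≠ 1` for all `i`.  Then for all sufficiently large
`|m₁|, …, |m_{n-1}|` and arbitrary nonzero `mₙ`, the element
`w = a₁ z^{m₁} ⋯ aₙ z^{mₙ}` does not commute with `z`; in particular `w ≠ 1`. -/
theorem stmt_5 {α : Type} (n : ℕ) (hn : 0 < n) (z : FreeGroup α) (hz : z ≠ 1)
    (a : Fin n → FreeGroup α) (ha : ∀ i, ¬ Commute (a i) z) :
    ∃ M : ℕ, ∀ m : Fin n → ℤ,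
      (∀ i : Fin n, (i : ℕ) < n - 1 → (M : ℤ) ≤ |m i|) →
      m ⟨n - 1, by omega⟩ ≠ 0 →
      ¬ Commute ((List.ofFn fun i : Fin n => a i * z ^ m i).prod) z ∧
        (List.ofFn fun i : Fin n => a i * z ^ m i).prod ≠ 1 := by
  classical
  obtain ⟨n, rfl⟩ := Nat.exists_eq_succ_of_ne_zero hn.ne'
  obtain ⟨c, hc⟩ := FreeGroup.exists_conj_isCyclicallyReduced z
  obtain ⟨M, hM⟩ := FreeGroup.exists_not_commute_prod_of_isCyclicallyReduced hc (by simpa using hz)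
    n (fun i => MulAut.conj c (a i))
    (fun i h => ha i ((MulAut.conj c).injective (by rw [map_mul, map_mul]; exact h.eq)))
  refine ⟨M, fun m hm _ => ?_⟩
  have key : ¬ Commute (List.ofFn fun i => a i * z ^ m i).prod z := fun h => by
    refine hM m hm ?_
    have := h.map (MulAut.conj c)
    rw [map_list_prod, List.map_ofFn] at this
    simpa only [Function.comp_def, map_mul, map_zpow] using this
  exact ⟨key, fun h => key (h ▸ Commute.one_left z)⟩
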